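/- arXiv:1306.2347 — 10 statements merged into one kernel-verified Lean document; each statement's English description precedes it below -/
import Mathlib

section
/- Let S be a finite multiset of pairs in ℝ × {−1,+1}, let k be a natural number, and let x₀ ∈ ℝ be such that |{(x,y) ∈ S : x ≥ x₀ and y = −1}| ≥ k + 1 (counted with multiplicity). Then every a* ∈ ℝ with errCount(S, h_{a*}) ≤ k satisfies a* > x₀. -/
/-- The threshold hypothesis `h_a`: returns `true` (i.e. label +1) iff `a ≤ x`. -/
noncomputable def threshold (a : ℝ) : ℝ → Bool := fun x => decide (a ≤ x)

/-- The number of pairs `(x, y)` in the multiset `S` (with multiplicity) on which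
the hypothesis `h` errs.  `true` encodes label +1, `false` label −1. -/
noncomputable def errCount (S : Multiset (ℝ × Bool)) (h : ℝ → Bool) : ℕ :=
  (S.filter (fun p => h p.1 ≠ p.2)).card

theorem low_error_threshold_above
    (S : Multiset (ℝ × Bool)) (k : ℕ) (x₀ : ℝ)
    (hneg : k + 1 ≤ (S.filter (fun p => x₀ ≤ p.1 ∧ p.2 = false)).card)
    (aStar : ℝ) (herr : errCount S (threshold aStar) ≤ k) :
    x₀ < aStar := by
  by_contra! ha
  have hle : (S.filter (fun p => x₀ ≤ p.1 ∧ p.2 = false)).card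
      ≤ errCount S (threshold aStar) := by
    refine Multiset.card_le_card (Multiset.monotone_filter_right S ?_)
    rintro p ⟨hx, hy⟩
    simp [threshold, hy, ha.trans hx]
  omega
end

section
/- Let S be a finite multiset of pairs in ℝ × {−1,+1} and let k be a natural number such that there exists a ∈ ℝ with errCount(S, h_a) ≤ k. Let x₀ ∈ ℝ be such that |{(x,y) ∈ S : x ≥ x₀ and y = −1}| ≥ k + 1, and let S' be the sub-multiset {(x,y) ∈ S : x ≥ x₀}. Then every â > x₀ satisfying errCount(S', h_â) ≤ errCount(S', h_a) for all a > x₀ also satisfies errCount(S, h_â) ≤ errCount(S, h_a) for all a ∈ ℝ; that is, minimizing the error over the queried suffix S' among thresholds above x₀ yields a global empirical error minimizer on S. -/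
/-- The error count splits over the part of the sample satisfying `P` and its complement. -/
theorem errCount_filter_add_errCount_filter_not (S : Multiset (ℝ × Bool)) (h : ℝ → Bool)
    (P : ℝ × Bool → Prop) [DecidablePred P] :
    errCount (S.filter P) h + errCount (S.filter fun p => ¬ P p) h = errCount S h := by
  unfold errCount
  rw [← Multiset.card_add, ← Multiset.filter_add, Multiset.filter_add_not]

/-- Hypotheses that agree on the sample have the same error count. -/
theorem errCount_congr {S : Multiset (ℝ × Bool)} {g h : ℝ → Bool}
    (hgh : ∀ p ∈ S, g p.1 = h p.1) : errCount S g = errCount S h := by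
  unfold errCount
  exact congrArg Multiset.card (Multiset.filter_congr fun p hp => by rw [hgh p hp])

theorem threshold_eq_false {a x : ℝ} (hx : x < a) : threshold a x = false := by
  simp [threshold, hx]

theorem threshold_eq_true {a x : ℝ} (hx : a ≤ x) : threshold a x = true := by
  simp [threshold, hx]

/-- A threshold at most `x₀` errs on every negative example at or above `x₀`. -/
theorem card_filter_negative_le_errCount (S : Multiset (ℝ × Bool)) {a x₀ : ℝ} (ha : a ≤ x₀) :
    (S.filter (fun p => x₀ ≤ p.1 ∧ p.2 = false)).card ≤ errCount S (threshold a) := by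
  refine Multiset.card_le_card (Multiset.monotone_filter_right S fun p hp => ?_)
  simp [threshold_eq_true (ha.trans hp.1), hp.2]

theorem suffix_minimizer_is_global_minimizer
    (S : Multiset (ℝ × Bool)) (k : ℕ)
    (hk : ∃ a : ℝ, errCount S (threshold a) ≤ k)
    (x₀ : ℝ)
    (hneg : k + 1 ≤ (S.filter (fun p => x₀ ≤ p.1 ∧ p.2 = false)).card)
    (S' : Multiset (ℝ × Bool)) (hS' : S' = S.filter (fun p => x₀ ≤ p.1))
    (aHat : ℝ) (haHat : x₀ < aHat)
    (hmin : ∀ a : ℝ, x₀ < a → errCount S' (threshold aHat) ≤ errCount S' (threshold a)) :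
    ∀ a : ℝ, errCount S (threshold aHat) ≤ errCount S (threshold a) := by
  have above : ∀ a : ℝ, x₀ < a → errCount S (threshold aHat) ≤ errCount S (threshold a) := by
    intro a ha
    have hprefix : errCount (S.filter fun p => ¬ x₀ ≤ p.1) (threshold aHat) =
        errCount (S.filter fun p => ¬ x₀ ≤ p.1) (threshold a) := by
      refine errCount_congr fun p hp => ?_
      have hpx : p.1 < x₀ := not_le.mp (Multiset.mem_filter.mp hp).2
      rw [threshold_eq_false (hpx.trans haHat), threshold_eq_false (hpx.trans ha)]
    rw [← errCount_filter_add_errCount_filter_not S (threshold aHat) (fun p => x₀ ≤ p.1),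
      ← errCount_filter_add_errCount_filter_not S (threshold a) (fun p => x₀ ≤ p.1),
      hprefix, ← hS']
    exact Nat.add_le_add_right (hmin a ha) _
  have below : ∀ a : ℝ, a ≤ x₀ → k + 1 ≤ errCount S (threshold a) := fun a ha =>
    hneg.trans (card_filter_negative_le_errCount S ha)
  intro a
  rcases lt_or_ge x₀ a with ha | ha
  · exact above a ha
  · obtain ⟨b, hb⟩ := hk
    have hxb : x₀ < b := by
      by_contra! hbx
      exact absurd (below b hbx) (by omega)
    have := above b hxb
    have := below a ha
    omega
end

section
/- Let S be a finite subset of ℝ × {−1,+1} and suppose there exists a* ∈ ℝ such that y = h_{a*}(x) for every (x,y) ∈ S (the pool is realizable by a threshold). Let N = {x : (x,−1) ∈ S} and assume N is nonempty. Then max N < a*, and for every a with max N < a ≤ a*, the hypothesis h_a satisfies h_a(x) = y for every (x,y) ∈ S. -/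
theorem realizable_threshold_scan
    (S : Finset (ℝ × Bool)) (aStar : ℝ)
    (hreal : ∀ p ∈ S, p.2 = threshold aStar p.1)
    (N : Finset ℝ) (hN : N = (S.filter (fun p => p.2 = false)).image Prod.fst)
    (hne : N.Nonempty) :
    N.max' hne < aStar ∧
      ∀ a : ℝ, N.max' hne < a → a ≤ aStar →
        ∀ p ∈ S, threshold a p.1 = p.2 := by
  have hmem : ∀ x, x ∈ N ↔ (x, false) ∈ S := by
    intro x
    simp [hN]
  constructor
  · have h := hreal _ ((hmem _).1 (N.max'_mem hne))
    simpa [threshold] using h.symm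
  · rintro a hlt hle ⟨x, y⟩ hp
    cases y with
    | false =>
      have hx : x < a := (N.le_max' x ((hmem x).2 hp)).trans_lt hlt
      simpa [threshold] using hx
    | true =>
      have hx : aStar ≤ x := by simpa [threshold] using (hreal _ hp).symm
      simpa [threshold] using hle.trans hx
end

section
/- Let d ≥ 1 and let S be a finite subset of ℝ₊^d × {−1,+1} such that there exists a* ∈ ℝ₊^d with y = h_{a*}(x) for every (x,y) ∈ S. Let N = {x : (x,−1) ∈ S} and assume N is nonempty. Then: (i) for every i ∈ [d], max_{z ∈ N} z_i < a*_i; (ii) for every i ∈ [d], every (x,y) ∈ S with x_i > max_{z ∈ N} z_i satisfies y = +1; and (iii) for every b ∈ ℝ₊^d such that max_{z ∈ N} z_i < b_i ≤ a*_i for all i ∈ [d], the hypothesis h_b satisfies h_b(x) = y for every (x,y) ∈ S. -/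
/-- The rectangle hypothesis `h_a` over the positive orthant (negative inside the box):
returns `true` (label +1) iff some coordinate `i` satisfies `x i ≥ a i`. -/
noncomputable def hypRect {d : ℕ} (a : Fin d → ℝ) (x : Fin d → ℝ) : Bool :=
  decide (∃ i : Fin d, a i ≤ x i)

theorem hypRect_eq_true_iff {d : ℕ} {a x : Fin d → ℝ} :
    hypRect a x = true ↔ ∃ i, a i ≤ x i := by
  simp [hypRect]

theorem hypRect_eq_false_iff {d : ℕ} {a x : Fin d → ℝ} :
    hypRect a x = false ↔ ∀ i, x i < a i := by
  simp [hypRect]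

theorem realizable_rectangle_scan
    (d : ℕ) (hd : 1 ≤ d)
    (S : Finset ((Fin d → ℝ) × Bool))
    (hSpos : ∀ p ∈ S, ∀ i : Fin d, 0 ≤ p.1 i)
    (aStar : Fin d → ℝ) (haStar : ∀ i, 0 ≤ aStar i)
    (hreal : ∀ p ∈ S, p.2 = hypRect aStar p.1)
    (N : Finset (Fin d → ℝ))
    (hN : N = (S.filter (fun p => p.2 = false)).image Prod.fst)
    (hne : N.Nonempty) :
    (∀ i : Fin d, N.sup' hne (fun z => z i) < aStar i) ∧
    (∀ i : Fin d, ∀ p ∈ S, N.sup' hne (fun z => z i) < p.1 i → p.2 = true) ∧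
    (∀ b : Fin d → ℝ, (∀ i, 0 ≤ b i) →
      (∀ i : Fin d, N.sup' hne (fun z => z i) < b i ∧ b i ≤ aStar i) →
      ∀ p ∈ S, hypRect b p.1 = p.2) := by
  have mem_N : ∀ {z}, z ∈ N ↔ (z, false) ∈ S := by simp [hN]
  have le_sup : ∀ p ∈ S, p.2 = false → ∀ i, p.1 i ≤ N.sup' hne (fun z => z i) := by
    rintro ⟨x, y⟩ hp rfl i
    exact Finset.le_sup' (fun z : Fin d → ℝ => z i) (mem_N.2 hp)
  refine ⟨fun i => ?_, fun i p hp hlt => ?_, fun b _ hb p hp => ?_⟩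
  · rw [Finset.sup'_lt_iff]
    exact fun z hz => hypRect_eq_false_iff.1 (hreal _ (mem_N.1 hz)).symm i
  · by_contra hy
    exact (le_sup p hp (Bool.eq_false_of_not_eq_true hy) i).not_gt hlt
  · cases hy : p.2
    · exact hypRect_eq_false_iff.2 fun i => (le_sup p hp hy i).trans_lt (hb i).1
    · obtain ⟨i, hi⟩ := hypRect_eq_true_iff.1 ((hreal p hp).symm.trans hy)
      exact hypRect_eq_true_iff.2 ⟨i, (hb i).2.trans hi⟩
end

section
/- For every integer d ≥ 2 and every natural number m ≥ 1, there exist m pairwise distinct points x_1, …, x_m ∈ ℝ₊^d such that: (a) there exists a ∈ ℝ₊^d with h_a^−(x_j) = −1 for all j ∈ [m]; and (b) for every j ∈ [m] there exists a_j ∈ ℝ₊^d with h_{a_j}^−(x_j) = +1 and h_{a_j}^−(x_k) = −1 for all k ≠ j. (The points may be taken on the intersection of the unit circle with the positive quadrant of the first two coordinates.) -/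
/-- The rectangle hypothesis `h_a⁻` over the positive orthant (positive inside the box):
returns `true` (label +1) iff every coordinate `i` satisfies `x i < a i`. -/
noncomputable def hypRectNeg {d : ℕ} (a : Fin d → ℝ) (x : Fin d → ℝ) : Bool :=
  decide (∀ i : Fin d, x i < a i)

theorem hypRectNeg_eq_true_iff {d : ℕ} (a x : Fin d → ℝ) :
    hypRectNeg a x = true ↔ ∀ i, x i < a i := by
  simp [hypRectNeg]

theorem hypRectNeg_eq_false_iff {d : ℕ} (a x : Fin d → ℝ) :
    hypRectNeg a x = false ↔ ∃ i, a i ≤ x i := by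
  simp [hypRectNeg]

/-- The point `(j, m - j, 0, …, 0)` on an antidiagonal of the first two coordinates. -/
noncomputable def antidiagonalPoint (d m : ℕ) (j : Fin m) (i : Fin d) : ℝ :=
  if i.val = 0 then (j : ℝ) else if i.val = 1 then (m : ℝ) - j else 0

theorem antidiagonalPoint_nonneg (d m : ℕ) (j : Fin m) (i : Fin d) :
    0 ≤ antidiagonalPoint d m j i := by
  have hj : (j : ℝ) ≤ m := by exact_mod_cast j.isLt.le
  unfold antidiagonalPoint
  split_ifs
  · positivity
  · linarith
  · exact le_rfl

/-- Distinct antidiagonal points differ by at least one, upwards, in some coordinate. -/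
theorem exists_antidiagonalPoint_add_one_le {d m : ℕ} (hd : 2 ≤ d) {j k : Fin m} (hkj : k ≠ j) :
    ∃ i, antidiagonalPoint d m j i + 1 ≤ antidiagonalPoint d m k i := by
  rcases lt_or_gt_of_ne hkj with h | h
  · have h' : (k : ℝ) + 1 ≤ j := by exact_mod_cast h
    refine ⟨⟨1, by omega⟩, ?_⟩
    simp only [antidiagonalPoint, one_ne_zero, if_true, if_false]
    linarith
  · have h' : (j : ℝ) + 1 ≤ k := by exact_mod_cast h
    refine ⟨⟨0, by omega⟩, ?_⟩
    simpa only [antidiagonalPoint, if_true] using h'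

theorem rectangle_neg_hard_pool
    (d m : ℕ) (hd : 2 ≤ d) (hm : 1 ≤ m) :
    ∃ x : Fin m → (Fin d → ℝ),
      Function.Injective x ∧
      (∀ j : Fin m, ∀ i : Fin d, 0 ≤ x j i) ∧
      (∃ a : Fin d → ℝ, (∀ i, 0 ≤ a i) ∧ ∀ j : Fin m, hypRectNeg a (x j) = false) ∧
      (∀ j : Fin m, ∃ aj : Fin d → ℝ, (∀ i, 0 ≤ aj i) ∧
        hypRectNeg aj (x j) = true ∧
        ∀ k : Fin m, k ≠ j → hypRectNeg aj (x k) = false) := by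
  refine ⟨antidiagonalPoint d m, fun j k hjk => ?_, antidiagonalPoint_nonneg d m,
    ⟨0, fun _ => le_rfl, fun j => ?_⟩, fun j => ⟨fun i => antidiagonalPoint d m j i + 1,
      fun i => add_nonneg (antidiagonalPoint_nonneg d m j i) zero_le_one, ?_, fun k hkj => ?_⟩⟩
  · by_contra hne
    obtain ⟨i, hi⟩ := exists_antidiagonalPoint_add_one_le hd hne
    rw [hjk] at hi
    linarith
  · exact (hypRectNeg_eq_false_iff _ _).2 ⟨⟨0, by omega⟩, antidiagonalPoint_nonneg d m j _⟩
  · exact (hypRectNeg_eq_true_iff _ _).2 fun i => lt_add_one _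
  · exact (hypRectNeg_eq_false_iff _ _).2 (exists_antidiagonalPoint_add_one_le hd hkj)
end

section
/- For nonnegative reals a, b, λ and reals n, m ≥ 1, define u^{(n,λ)} = max(n·u, u + (n−1)·λ) for u ≥ 0. If a ≤ b^{(n,λ)}, then a^{(m,λ)} ≤ b^{(mn,λ)}. -/
/-- The multiplicative/additive upper bound `u^{(n,λ)} = max (n·u) (u + (n−1)·λ)`. -/
def apBound (u n lam : ℝ) : ℝ := max (n * u) (u + (n - 1) * lam)

theorem apBound_comp
    (a b lam n m : ℝ)
    (ha : 0 ≤ a) (hb : 0 ≤ b) (hlam : 0 ≤ lam)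
    (hn : 1 ≤ n) (hm : 1 ≤ m)
    (h : a ≤ apBound b n lam) :
    apBound a m lam ≤ apBound b (m * n) lam := by
  unfold apBound at *
  have hm' : 0 ≤ m - 1 := sub_nonneg.2 hm
  have hn' : 0 ≤ n - 1 := sub_nonneg.2 hn
  rcases le_total lam b with hlb | hbl
  · have hab : a ≤ n * b := h.trans (max_le le_rfl (by nlinarith))
    refine le_max_of_le_left (max_le ?_ ?_)
    · nlinarith
    · nlinarith [mul_nonneg hm' (sub_nonneg.2 hlb), mul_nonneg (mul_nonneg hm' hn') hb]
  · have hab : a ≤ b + (n - 1) * lam := h.trans (max_le (by nlinarith) le_rfl)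
    refine le_max_of_le_right (max_le ?_ ?_)
    · nlinarith [mul_nonneg hm' (sub_nonneg.2 hbl), mul_nonneg hm' (sub_nonneg.2 hab)]
    · nlinarith [mul_nonneg (mul_nonneg hm' hn') hlam]
end

section
/- For all natural numbers n ≥ 1 and d ≥ 1, if 2^n ≤ (e·n/d)^{2d} (where e is Euler's number), then n ≤ 10·d. -/
/-- The tangent line to `Real.log` at `8` lies above its graph. -/
theorem log_le_three_mul_log_two_add {x : ℝ} (hx : 0 < x) :
    Real.log x ≤ 3 * Real.log 2 + x / 8 - 1 := by
  have h := Real.log_le_sub_one_of_pos (show 0 < x / 8 by positivity)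
  have h8 : Real.log 8 = 3 * Real.log 2 := by
    rw [show (8 : ℝ) = 2 ^ 3 by norm_num, Real.log_pow]
    norm_num
  rw [Real.log_div hx.ne' (by norm_num), h8] at h
  linarith

theorem sauer_numeric_bound
    (n d : ℕ) (hn : 1 ≤ n) (hd : 1 ≤ d)
    (h : (2 : ℝ) ^ n ≤ (Real.exp 1 * n / d) ^ (2 * d)) :
    n ≤ 10 * d := by
  have hn0 : (0 : ℝ) < n := by exact_mod_cast hn
  have hd0 : (0 : ℝ) < d := by exact_mod_cast hd
  have hx : (0 : ℝ) < n / d := by positivity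
  have hlog := Real.log_le_log (by positivity) h
  rw [Real.log_pow, Real.log_pow, mul_div_assoc, Real.log_mul (Real.exp_pos 1).ne' hx.ne',
    Real.log_exp] at hlog
  push_cast at hlog
  have hbound : (n : ℝ) * Real.log 2 ≤ 6 * Real.log 2 * d + n / 4 :=
    calc (n : ℝ) * Real.log 2 ≤ 2 * d * (1 + Real.log (n / d)) := hlog
      _ ≤ 2 * d * (1 + (3 * Real.log 2 + n / d / 8 - 1)) := by
        gcongr
        exact log_le_three_mul_log_two_add hx
      _ = 6 * Real.log 2 * d + n / 4 := by
        field_simp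
        ring
  have hlow := Real.log_two_gt_d9
  by_contra! hlt
  have hlt' : 10 * (d : ℝ) < n := by exact_mod_cast hlt
  nlinarith
end

section
/- Let X be a set, let H be a set of functions from X to {−1,+1}, and let d ≥ 1 be such that every finite subset of X shattered by H has at most d elements. Define the family F of functions from X × {−1,+1} to {−1,+1} by F = {g_{h₁,h₂} : h₁, h₂ ∈ H}, where g_{h₁,h₂}(x,y) = +1 if (h₁(x) = y or h₂(x) = −1) and g_{h₁,h₂}(x,y) = −1 otherwise. Then every finite subset of X × {−1,+1} shattered by F has at most 10·d elements. -/
/-- A family `F` of Bool-valued functions on `Z` shatters a finite set `T ⊆ Z` if every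
Bool-labeling of `T` is realized by some member of `F`.  `true` encodes +1, `false` −1. -/
def Shatters {Z : Type*} (F : Set (Z → Bool)) (T : Finset Z) : Prop :=
  ∀ τ : Z → Bool, ∃ f ∈ F, ∀ z ∈ T, f z = τ z

/-- A weighted form of the Sauer–Shelah bound: if a family of subsets of `T` shatters only sets of
size at most `d`, then it has at most `(c + 1) ^ |T| / c ^ (|T| - d)` members. -/
lemma card_mul_pow_le_of_shatters_card_le {α : Type*} [DecidableEq α] {𝒜 : Finset (Finset α)}
    {T : Finset α} {d c : ℕ} (hT : ∀ A ∈ 𝒜, A ⊆ T) (hd : ∀ U, 𝒜.Shatters U → U.card ≤ d)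
    (hc : 1 ≤ c) : 𝒜.card * c ^ (T.card - d) ≤ (c + 1) ^ T.card := by
  have hsub : 𝒜.shatterer ⊆ T.powerset := fun U hU ↦ by
    obtain ⟨A, hA, hUA⟩ := (Finset.mem_shatterer.1 hU).exists_superset
    exact Finset.mem_powerset.2 (hUA.trans (hT A hA))
  calc 𝒜.card * c ^ (T.card - d)
      ≤ 𝒜.shatterer.card * c ^ (T.card - d) :=
        Nat.mul_le_mul_right _ (Finset.card_le_card_shatterer 𝒜)
    _ = ∑ U ∈ 𝒜.shatterer, c ^ (T.card - d) := by simp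
    _ ≤ ∑ U ∈ 𝒜.shatterer, 1 ^ U.card * c ^ (T.card - U.card) := by
        refine Finset.sum_le_sum fun U hU ↦ ?_
        rw [one_pow, one_mul]
        have := hd U (Finset.mem_shatterer.1 hU)
        exact Nat.pow_le_pow_right hc (by lia)
    _ ≤ ∑ U ∈ T.powerset, 1 ^ U.card * c ^ (T.card - U.card) :=
        Finset.sum_le_sum_of_subset hsub
    _ = (c + 1) ^ T.card := by rw [Finset.sum_pow_mul_eq_add_pow, add_comm]

lemma Shatters.subset {Z : Type*} {F : Set (Z → Bool)} {S T : Finset Z} (hT : Shatters F T)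
    (hST : S ⊆ T) : Shatters F S := fun τ ↦
  let ⟨f, hf, h⟩ := hT τ
  ⟨f, hf, fun z hz ↦ h z (hST hz)⟩

/-- If the traces on `T` of a class pulled back along `π` shatter `U`, then the class shatters
the image of `U`, and `π` is injective on `U`. -/
lemma shatters_image_of_shatters_traces {X Z : Type*} [DecidableEq X] [DecidableEq Z]
    {H : Set (X → Bool)} {π : Z → X} {T U : Finset Z} {𝒜 : Finset (Finset Z)}
    (h𝒜 : ∀ A ∈ 𝒜, ∃ h ∈ H, T.filter (fun z ↦ h (π z) = true) = A) (hU : 𝒜.Shatters U) :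
    Shatters H (U.image π) ∧ Set.InjOn π U := by
  have hUT : U ⊆ T := by
    obtain ⟨A, hA, hUA⟩ := hU.exists_superset
    obtain ⟨h, -, rfl⟩ := h𝒜 A hA
    exact hUA.trans (Finset.filter_subset _ _)
  have key : ∀ V ⊆ U, ∃ h ∈ H, ∀ z ∈ U, h (π z) = true ↔ z ∈ V := by
    intro V hV
    obtain ⟨A, hA, hUA⟩ := hU hV
    obtain ⟨h, hh, rfl⟩ := h𝒜 A hA
    refine ⟨h, hh, fun z hz ↦ ?_⟩
    rw [← hUA]
    simp [hz, hUT hz]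
  constructor
  · intro τ
    obtain ⟨h, hh, hz⟩ := key (U.filter fun z ↦ τ (π z) = true) (Finset.filter_subset _ _)
    refine ⟨h, hh, fun x hx ↦ ?_⟩
    obtain ⟨z, hzU, rfl⟩ := Finset.mem_image.1 hx
    rw [Bool.eq_iff_iff, hz z hzU]
    simp [hzU]
  · intro a ha b hb hab
    obtain ⟨h, -, hz⟩ := key {a} (Finset.singleton_subset_iff.2 ha)
    have hb' := hz b hb
    rw [← hab, hz a ha] at hb'
    simpa [eq_comm] using hb'

theorem vc_dim_pair_class
    {X : Type*} (H : Set (X → Bool)) (d : ℕ) (hd : 1 ≤ d)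
    (hH : ∀ T : Finset X, Shatters H T → T.card ≤ d) :
    ∀ T : Finset (X × Bool),
      Shatters
        { g : X × Bool → Bool |
          ∃ h₁ ∈ H, ∃ h₂ ∈ H,
            g = fun p => (h₁ p.1 == p.2) || (h₂ p.1 == false) } T →
      T.card ≤ 10 * d := by
  classical
  intro T₀ hT₀
  by_contra! hlt
  obtain ⟨T, hTT₀, hcard⟩ := Finset.exists_subset_card_eq (Nat.succ_le_of_lt hlt)
  have hT := hT₀.subset hTT₀
  let trace : (X → Bool) → Finset (X × Bool) := fun h ↦ T.filter fun z ↦ h z.1 = true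
  let 𝒜 : Finset (Finset (X × Bool)) := T.powerset.filter fun A ↦ ∃ h ∈ H, trace h = A
  have mem_traces : ∀ h ∈ H, trace h ∈ 𝒜 := fun h hh ↦
    Finset.mem_filter.2 ⟨Finset.mem_powerset.2 (Finset.filter_subset _ _), h, hh, rfl⟩
  have card_traces : 𝒜.card * 9 ^ (T.card - d) ≤ (9 + 1) ^ T.card := by
    refine card_mul_pow_le_of_shatters_card_le
      (fun A hA ↦ Finset.mem_powerset.1 (Finset.mem_filter.1 hA).1) (fun U hU ↦ ?_) (by norm_num)
    obtain ⟨hs, hinj⟩ := shatters_image_of_shatters_traces (H := H) (π := Prod.fst) (T := T)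
      (fun A hA ↦ (Finset.mem_filter.1 hA).2) hU
    rw [← Finset.card_image_of_injOn hinj]
    exact hH _ hs
  have two_pow_le : 2 ^ T.card ≤ 𝒜.card * 𝒜.card := by
    rw [← Finset.card_powerset, ← Finset.card_product]
    refine Finset.card_le_card_of_surjOn
      (fun P ↦ T.filter fun z ↦ ((decide (z ∈ P.1) == z.2) || (decide (z ∈ P.2) == false)) = true)
      fun S hS ↦ ?_
    have hST : S ⊆ T := Finset.mem_powerset.1 hS
    obtain ⟨_, ⟨h₁, hh₁, h₂, hh₂, rfl⟩, hg⟩ := hT fun z ↦ decide (z ∈ S)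
    refine ⟨(trace h₁, trace h₂), Finset.mem_product.2 ⟨mem_traces h₁ hh₁, mem_traces h₂ hh₂⟩, ?_⟩
    ext z
    by_cases hz : z ∈ T
    · have hgz := Bool.eq_iff_iff.1 (hg z hz)
      simpa [trace, hz] using hgz
    · simpa [hz] using fun h ↦ hz (hST h)
  rw [hcard] at card_traces two_pow_le
  have hexp : 10 * d + 1 - d = 9 * d + 1 := by lia
  simp only [Nat.succ_eq_add_one, hexp] at card_traces two_pow_le
  have hle : 2 ^ (10 * d + 1) * (9 ^ (9 * d + 1) * 9 ^ (9 * d + 1)) ≤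
      10 ^ (10 * d + 1) * 10 ^ (10 * d + 1) := by
    calc _ ≤ 𝒜.card * 𝒜.card * (9 ^ (9 * d + 1) * 9 ^ (9 * d + 1)) := by gcongr
      _ = (𝒜.card * 9 ^ (9 * d + 1)) * (𝒜.card * 9 ^ (9 * d + 1)) := by ring
      _ ≤ _ := Nat.mul_le_mul card_traces card_traces
  have hpow : (10 ^ 20) ^ d ≤ (2 ^ 10 * 9 ^ 18) ^ d := Nat.pow_le_pow_left (by norm_num) d
  have hleft : 2 ^ (10 * d + 1) * (9 ^ (9 * d + 1) * 9 ^ (9 * d + 1)) =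
      162 * (2 ^ 10 * 9 ^ 18) ^ d := by
    rw [mul_pow, ← pow_mul, ← pow_mul]; ring
  have hright : 10 ^ (10 * d + 1) * 10 ^ (10 * d + 1) = 100 * (10 ^ 20) ^ d := by
    rw [← pow_mul]; ring
  rw [hleft, hright] at hle
  have hpos : 0 < (10 ^ 20) ^ d := by positivity
  lia
end

section
/- Let λ ∈ (0,1), let M be a natural number, let s ≥ 0 be real, and let p_1, …, p_M ∈ [0,1] with Σ_{t=1}^M p_t ≤ s. Then ∏_{t=1}^M (1 − (1−λ)·p_t) ≥ exp(−2·(1−λ)·s·(1 + ln(1/λ))). -/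
theorem exp_neg_two_mul_le_one_sub {x : ℝ} (hx0 : 0 ≤ x) (hx : x ≤ 1 / 2) :
    Real.exp (-(2 * x)) ≤ 1 - x := by
  rw [Real.exp_neg]
  refine inv_le_of_inv_le₀ (by linarith) ?_
  rw [inv_le_iff_one_le_mul₀ (by linarith)]
  nlinarith [Real.add_one_le_exp (2 * x)]

theorem exp_neg_two_mul_one_add_log_le_one_sub {lam x : ℝ} (hlam0 : 0 < lam) (hlam1 : lam ≤ 1)
    (hx0 : 0 ≤ x) (hx : x ≤ 1 - lam) :
    Real.exp (-(2 * x * (1 + Real.log (1 / lam)))) ≤ 1 - x := by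
  have hlog : 0 ≤ Real.log (1 / lam) := Real.log_nonneg (one_le_one_div hlam0 hlam1)
  rcases le_or_gt x (1 / 2) with h | h
  · refine le_trans (Real.exp_le_exp.mpr ?_) (exp_neg_two_mul_le_one_sub hx0 h)
    nlinarith [mul_nonneg hx0 hlog]
  · calc Real.exp (-(2 * x * (1 + Real.log (1 / lam))))
        ≤ Real.exp (-Real.log (1 / lam)) := Real.exp_le_exp.mpr (by nlinarith)
      _ = lam := by rw [one_div, Real.log_inv, neg_neg, Real.exp_log hlam0]
      _ ≤ 1 - x := by linarith

theorem product_lower_bound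
    (lam : ℝ) (hlam0 : 0 < lam) (hlam1 : lam < 1)
    (M : ℕ) (s : ℝ) (hs : 0 ≤ s)
    (p : Fin M → ℝ) (hp : ∀ t, p t ∈ Set.Icc (0 : ℝ) 1)
    (hsum : ∑ t, p t ≤ s) :
    Real.exp (-2 * (1 - lam) * s * (1 + Real.log (1 / lam)))
      ≤ ∏ t, (1 - (1 - lam) * p t) := by
  have hlog : 0 ≤ Real.log (1 / lam) := Real.log_nonneg (one_le_one_div hlam0 hlam1.le)
  have hcoef : 0 ≤ 2 * (1 - lam) * (1 + Real.log (1 / lam)) :=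
    mul_nonneg (by linarith) (by linarith)
  calc Real.exp (-2 * (1 - lam) * s * (1 + Real.log (1 / lam)))
      ≤ Real.exp (-(2 * (1 - lam) * (1 + Real.log (1 / lam)) * ∑ t, p t)) :=
        Real.exp_le_exp.mpr (by linarith [mul_le_mul_of_nonneg_left hsum hcoef])
    _ = ∏ t, Real.exp (-(2 * ((1 - lam) * p t) * (1 + Real.log (1 / lam)))) := by
        rw [← Real.exp_sum, Finset.mul_sum, ← Finset.sum_neg_distrib]
        congr 1
        exact Finset.sum_congr rfl fun t _ => by ring
    _ ≤ ∏ t, (1 - (1 - lam) * p t) :=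
        Finset.prod_le_prod (fun t _ => (Real.exp_pos _).le) fun t _ =>
          exp_neg_two_mul_one_add_log_le_one_sub hlam0 hlam1.le
            (mul_nonneg (by linarith) (hp t).1)
            (mul_le_of_le_one_right (by linarith) (hp t).2)
end

section
/- Let d ≥ 1, let S be a finite subset of ℝ₊^d × {−1,+1}, let a* ∈ ℝ₊^d, and let b ∈ ℝ₊^d. Let K = |{(x,y) ∈ S : y = −1 and h_{a*}(x) = +1}| be the number of negative points of S misclassified by h_{a*}. If for every i ∈ [d] the number of points (x,y) ∈ S with y = −1 and x_i ≥ b_i is strictly greater than K, then a*_i > b_i for every i ∈ [d]. -/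
theorem optimal_rectangle_above_b
    (d : ℕ) (hd : 1 ≤ d)
    (S : Finset ((Fin d → ℝ) × Bool))
    (hSpos : ∀ p ∈ S, ∀ i : Fin d, 0 ≤ p.1 i)
    (aStar b : Fin d → ℝ) (haStar : ∀ i, 0 ≤ aStar i) (hb : ∀ i, 0 ≤ b i)
    (K : ℕ)
    (hK : K = (S.filter (fun p => p.2 = false ∧ hypRect aStar p.1 = true)).card)
    (hcount : ∀ i : Fin d, K < (S.filter (fun p => p.2 = false ∧ b i ≤ p.1 i)).card) :
    ∀ i : Fin d, b i < aStar i := by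
  intro i
  by_contra! hi
  refine (hcount i).not_ge (hK ▸ Finset.card_le_card ?_)
  refine Finset.monotone_filter_right S fun p _ hp => ⟨hp.1, ?_⟩
  exact decide_eq_true ⟨i, hi.trans hp.2⟩
end
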